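/- (Ghoussoub–Preiss) Let n ≥ 1, T > 0, and let H : ℝ × ℝ^{2n} → ℝ be a C² function such that: H(t, ·) is convex for every t; H(·, x) is T-periodic for every x; there exists a function n : [0,∞) → ℝ with n(s)/s → +∞ as s → +∞ and H(t, x) ≥ n(‖x‖) for all (t, x); for every ε > 0 there exists c ∈ ℝ with H(t, x) ≤ (ε/2)‖x‖² + c for all (t, x); and the Hessian H''_{xx}(t, x) is positive definite for every (t, x). Then there exists a sequence (x_k)_{k ∈ ℕ}, where each x_k : ℝ → ℝ^{2n} is a C¹ kT-periodic solution of ẋ = J ∇_x H(t, x), such that for every k ∈ ℕ there is some p₀ ∈ ℕ with: p ≥ p₀ implies x_{pk} ≠ x_k (as functions). -/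

import Mathlib

open scoped RealInnerProductSpace
open Real Filter

/-- The standard `2n × 2n` symplectic matrix `J = [[0, Iₙ], [-Iₙ, 0]]`. -/
noncomputable def symplecticJ (n : ℕ) : Matrix (Fin (2*n)) (Fin (2*n)) ℝ :=
  Matrix.reindex (finSumFinEquiv.trans (finCongr (two_mul n).symm))
    (finSumFinEquiv.trans (finCongr (two_mul n).symm))
    (Matrix.fromBlocks 0 1 (-1) 0)

/-- The Hessian matrix of `H : ℝ^m → ℝ` at `ξ`, with entries the second derivatives in the
coordinate directions. -/
noncomputable def hessianMatrix {m : ℕ} (H : EuclideanSpace ℝ (Fin m) → ℝ)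
    (ξ : EuclideanSpace ℝ (Fin m)) : Matrix (Fin m) (Fin m) ℝ :=
  Matrix.of fun i j =>
    iteratedFDeriv ℝ 2 H ξ ![EuclideanSpace.single i 1, EuclideanSpace.single j 1]


/-! ### Legendre duality for one convex function -/

lemma gp_dual {E : Type*} [NormedAddCommGroup E] [InnerProductSpace ℝ E] [FiniteDimensional ℝ E]
    (K : E → ℝ) (G : E → E) (hG : Continuous G)
    (hgrad : ∀ x, HasGradientAt K (G x) x)
    (hineq : ∀ x y, K x + ⟪G x, y - x⟫ ≤ K y)
    (hinj : Function.Injective G)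
    (hcoer : ∀ κ : ℝ, ∃ C : ℝ, ∀ x, κ * ‖x‖ - C ≤ K x) :
    ∃ (Z : E → E) (L : E → ℝ), Continuous Z ∧ Continuous L ∧ (∀ u, G (Z u) = u) ∧
      (∀ u, L u = ⟪u, Z u⟫ - K (Z u)) ∧ ∀ u w, ⟪u, w⟫ - K w ≤ L u := by
  have hKc : Continuous K := by
    rw [continuous_iff_continuousAt]
    intro x
    exact (hgrad x).hasFDerivAt.continuousAt
  have hsurj : Function.Surjective G := by
    intro u
    obtain ⟨C, hC⟩ := hcoer (‖u‖ + 1)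
    have hc : Continuous (fun x => K x - ⟪u, x⟫) := by fun_prop
    have ht : Tendsto (fun x => K x - ⟪u, x⟫) (cocompact E) atTop := by
      have h1 : Tendsto (fun x : E => ‖x‖ + (-C)) (cocompact E) atTop :=
        tendsto_atTop_add_const_right _ _ (tendsto_norm_cocompact_atTop)
      refine tendsto_atTop_mono (fun x => ?_) h1
      have h2 := hC x
      have h3 := real_inner_le_norm u x
      nlinarith
    obtain ⟨x, hx⟩ := hc.exists_forall_le ht
    refine ⟨x, ?_⟩
    have hd : HasFDerivAt (fun x => K x - ⟪u, x⟫)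
        ((InnerProductSpace.toDual ℝ E (G x)) - (innerSL ℝ u)) x :=
      (hgrad x).hasFDerivAt.sub (innerSL ℝ u).hasFDerivAt
    have hmin : IsLocalMin (fun x => K x - ⟪u, x⟫) x := Filter.Eventually.of_forall hx
    have h0 := hmin.hasFDerivAt_eq_zero hd
    have h1 : ∀ v, ⟪G x - u, v⟫ = 0 := by
      intro v
      have := congrArg (fun f => f v) h0
      simpa [inner_sub_left] using this
    have h2 := h1 (G x - u)
    rw [inner_self_eq_zero] at h2
    exact sub_eq_zero.mp h2
  have hproper : IsProperMap G := by
    rw [isProperMap_iff_tendsto_cocompact]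
    refine ⟨hG, ?_⟩
    rw [← Metric.cobounded_eq_cocompact, ← tendsto_norm_atTop_iff_cobounded]
    rw [tendsto_atTop]
    intro b
    obtain ⟨C, hC⟩ := hcoer (b + 1)
    have h1 : ∀ᶠ x : E in Bornology.cobounded E, max 1 (C + K 0) ≤ ‖x‖ :=
      tendsto_norm_cobounded_atTop.eventually_ge_atTop _
    filter_upwards [h1] with x hx
    have hx1 : 1 ≤ ‖x‖ := le_trans (le_max_left _ _) hx
    have hx2 : C + K 0 ≤ ‖x‖ := le_trans (le_max_right _ _) hx
    have h2 := hineq x 0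
    have h3 := hC x
    have h4 := real_inner_le_norm (G x) x
    simp only [zero_sub, inner_neg_right] at h2
    by_contra hlt
    push Not at hlt
    have : ‖G x‖ * ‖x‖ < b * ‖x‖ := mul_lt_mul_of_pos_right hlt (by linarith)
    nlinarith
  let e := Equiv.ofBijective G ⟨hinj, hsurj⟩
  let φ := e.toHomeomorphOfContinuousClosed hG hproper.isClosedMap
  have hGZ : ∀ u, G (e.symm u) = u := fun u => e.apply_symm_apply u
  have hZc : Continuous e.symm := φ.symm.continuous
  refine ⟨e.symm, fun u => ⟪u, e.symm u⟫ - K (e.symm u), hZc, ?_, hGZ, fun _ => rfl, ?_⟩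
  · exact (continuous_id.inner hZc).sub (hKc.comp hZc)
  · intro u w
    have := hineq (e.symm u) w
    rw [hGZ, inner_sub_right] at this
    linarith

/-! ### Passing to the limit in a difference scheme -/

lemma gp_sum_bound {V : Type*} [NormedAddCommGroup V] [NormedSpace ℝ V]
    (Y f : ℤ → V) (h : ℝ) (hh : 0 ≤ h) (hY : ∀ i, Y (i + 1) - Y i = h • f i) (v : V) (ε : ℝ)
    (i j : ℤ) (hij : i ≤ j) (hf : ∀ l, i ≤ l → l < j → ‖f l - v‖ ≤ ε) :
    ‖Y j - Y i - (((j : ℝ) - i) * h) • v‖ ≤ ε * (((j : ℝ) - i) * h) := by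
  induction j, hij using Int.leInduction with
  | base => simp
  | succ j hij ih =>
    have h1 := ih (fun l h1 h2 => hf l h1 (by omega))
    have h2 := hf j hij (by omega)
    have h3 : Y (j + 1) - Y i - ((((j + 1 : ℤ) : ℝ) - i) * h) • v
        = (Y j - Y i - (((j : ℝ) - i) * h) • v) + h • (f j - v) := by
      have : Y (j + 1) = Y j + h • f j := by rw [← hY]; abel
      rw [this]
      push_cast
      module
    rw [h3]
    refine (norm_add_le _ _).trans ?_
    rw [norm_smul, Real.norm_eq_abs, abs_of_nonneg hh]
    push_cast
    nlinarith [mul_le_mul_of_nonneg_left h2 hh]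

lemma gp_floor_tendsto {l : Filter ℕ} (h : ℕ → ℝ) (hpos : ∀ N, 0 < h N)
    (hlim : Tendsto h l (nhds 0)) (t : ℝ) :
    Tendsto (fun N => ((⌊t / h N⌋ : ℤ) : ℝ) * h N) l (nhds t) := by
  have h1 : Tendsto (fun N => t - h N) l (nhds t) := by
    simpa using tendsto_const_nhds.sub hlim
  refine tendsto_of_tendsto_of_tendsto_of_le_of_le h1 tendsto_const_nhds (fun N => ?_) (fun N => ?_)
  · have := Int.lt_floor_add_one (t / h N)
    rw [div_lt_iff₀ (hpos N)] at this
    show t - h N ≤ _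
    nlinarith
  · have := Int.floor_le (t / h N)
    rw [le_div_iff₀ (hpos N)] at this
    exact this

lemma gp_limit {E V : Type*} [NormedAddCommGroup E] [NormedSpace ℝ E]
    [NormedAddCommGroup V] [NormedSpace ℝ V]
    (l : Filter ℕ) [l.NeBot] (h : ℕ → ℝ) (hpos : ∀ N, 0 < h N) (hlim : Tendsto h l (nhds 0))
    (F : ℝ → E → V) (hF : Continuous (Function.uncurry F))
    (Y : ℕ → ℤ → V) (z : ℕ → ℤ → E)
    (hY : ∀ N i, Y N (i + 1) - Y N i = h N • F (i * h N) (z N i))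
    (M : ℝ) (hM : 0 ≤ M) (hz : ∀ N i j, ‖z N i - z N j‖ ≤ M * (|(i : ℝ) - j| * h N))
    (ζ : ℝ → E) (y : ℝ → V)
    (hζ : ∀ t, Tendsto (fun N => z N ⌊t / h N⌋) l (nhds (ζ t)))
    (hy : ∀ t, Tendsto (fun N => Y N ⌊t / h N⌋) l (nhds (y t))) (t : ℝ) :
    HasDerivAt y (F t (ζ t)) t := by
  rw [hasDerivAt_iff_isLittleO]
  rw [Asymptotics.isLittleO_iff]
  intro ε hε
  set v := F t (ζ t) with hv
  obtain ⟨δ, hδ, hδF⟩ := Metric.continuousAt_iff.mp (hF.continuousAt (x := (t, ζ t))) ε hε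
  -- choose a neighbourhood of `t`
  set η := δ / (4 * (M + 1)) with hη
  have hηpos : 0 < η := by positivity
  have hηM : η * (M + 1) = δ / 4 := by rw [hη]; field_simp
  have hηδ : η ≤ δ / 4 := by nlinarith
  filter_upwards [Metric.ball_mem_nhds t hηpos] with s hs
  rw [Metric.mem_ball, Real.dist_eq] at hs
  have hlimY : Tendsto (fun N => ‖Y N ⌊s / h N⌋ - Y N ⌊t / h N⌋ -
      (((⌊s / h N⌋ : ℤ) : ℝ) * h N - ((⌊t / h N⌋ : ℤ) : ℝ) * h N) • v‖) l
      (nhds ‖y s - y t - (s - t) • v‖) :=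
    ((((hy s).sub (hy t)).sub (((gp_floor_tendsto h hpos hlim s).sub
      (gp_floor_tendsto h hpos hlim t)).smul_const v))).norm
  have hlimR : Tendsto (fun N => ε * |((⌊s / h N⌋ : ℤ) : ℝ) * h N - ((⌊t / h N⌋ : ℤ) : ℝ) * h N|) l
      (nhds (ε * |s - t|)) :=
    (((gp_floor_tendsto h hpos hlim s).sub (gp_floor_tendsto h hpos hlim t)).abs).const_mul ε
  rw [Real.norm_eq_abs]
  refine le_of_tendsto_of_tendsto hlimY hlimR ?_
  have e1 : ∀ᶠ N in l, |((⌊t / h N⌋ : ℤ) : ℝ) * h N - t| < η := by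
    have := (Metric.tendsto_nhds.mp (gp_floor_tendsto h hpos hlim t)) η hηpos
    simpa [Real.dist_eq] using this
  have e2 : ∀ᶠ N in l, |((⌊s / h N⌋ : ℤ) : ℝ) * h N - s| < η := by
    have := (Metric.tendsto_nhds.mp (gp_floor_tendsto h hpos hlim s)) η hηpos
    simpa [Real.dist_eq] using this
  have e3 : ∀ᶠ N in l, dist (z N ⌊t / h N⌋) (ζ t) < δ / 4 :=
    (Metric.tendsto_nhds.mp (hζ t)) (δ / 4) (by positivity)
  filter_upwards [e1, e2, e3] with N h1 h2 h3
  have hN := hpos N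
  set i := ⌊t / h N⌋
  set j := ⌊s / h N⌋
  rw [abs_lt] at h1 h2 hs
  have key : ∀ q : ℤ, min i j ≤ q → q ≤ max i j → ‖F (q * h N) (z N q) - v‖ ≤ ε := by
    intro q hq1 hq2
    rw [← dist_eq_norm]
    have hq1' : min ((i : ℝ) * h N) (j * h N) ≤ q * h N := by
      rcases min_le_iff.mp hq1 with hh | hh
      · exact (min_le_left _ _).trans (mul_le_mul_of_nonneg_right (by exact_mod_cast hh) hN.le)
      · exact (min_le_right _ _).trans (mul_le_mul_of_nonneg_right (by exact_mod_cast hh) hN.le)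
    have hq2' : q * h N ≤ max ((i : ℝ) * h N) (j * h N) := by
      rcases le_max_iff.mp hq2 with hh | hh
      · exact le_trans (mul_le_mul_of_nonneg_right (by exact_mod_cast hh) hN.le) (le_max_left _ _)
      · exact le_trans (mul_le_mul_of_nonneg_right (by exact_mod_cast hh) hN.le) (le_max_right _ _)
    have hqt : |q * h N - t| < 2 * η := by
      rw [abs_lt]
      constructor
      · rcases min_le_iff.mp hq1' with hh | hh <;> linarith
      · rcases le_max_iff.mp hq2' with hh | hh <;> linarith
    have hqi : |(q : ℝ) - i| * h N ≤ 3 * η := by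
      rw [← abs_of_pos hN, ← abs_mul, abs_le]
      rw [abs_lt] at hqt
      constructor <;> nlinarith
    have hzq := hz N q i
    refine (hδF (x := (q * h N, z N q)) ?_).le
    rw [Prod.dist_eq]
    refine max_lt ?_ ?_
    · rw [Real.dist_eq]
      show |q * h N - t| < δ
      linarith
    · show dist (z N q) (ζ t) < δ
      have : dist (z N q) (z N i) ≤ M * (3 * η) := by
        rw [dist_eq_norm]
        exact hzq.trans (mul_le_mul_of_nonneg_left hqi hM)
      have h5 := dist_triangle (z N q) (z N i) (ζ t)
      nlinarith
  rcases le_total i j with hij | hij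
  · have := gp_sum_bound (Y N) (fun q => F (q * h N) (z N q)) (h N) hN.le (hY N) v ε i j hij
      (fun q hq1 hq2 => key q (by simp [hij, hq1]) (by simp [hij, hq2.le]))
    rw [← sub_mul, abs_of_nonneg (mul_nonneg (sub_nonneg.mpr (by exact_mod_cast hij)) hN.le)]
    exact this
  · have := gp_sum_bound (Y N) (fun q => F (q * h N) (z N q)) (h N) hN.le (hY N) v ε j i hij
      (fun q hq1 hq2 => key q (by simp [hij, hq1]) (by simp [hij, hq2.le]))
    rw [abs_sub_comm, ← sub_mul, ← sub_mul,
      abs_of_nonneg (mul_nonneg (sub_nonneg.mpr (by exact_mod_cast hij)) hN.le)]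
    refine le_of_eq_of_le ?_ this
    rw [← norm_neg]
    congr 1
    module

/-! ### Sums and paths over `ZMod N` -/

lemma gp_sum_range {α : Type*} [AddCommMonoid α] (N : ℕ) [NeZero N] (f : ZMod N → α) :
    ∑ l ∈ Finset.range N, f (l : ZMod N) = ∑ i, f i := by
  refine Finset.sum_bij (fun l _ => (l : ZMod N)) (fun _ _ => Finset.mem_univ _) ?_ ?_ ?_
  · intro a ha b hb hab
    rw [Finset.mem_range] at ha hb
    have := (ZMod.natCast_eq_natCast_iff' a b N).mp hab
    rwa [Nat.mod_eq_of_lt ha, Nat.mod_eq_of_lt hb] at this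
  · intro i _
    exact ⟨i.val, Finset.mem_range.mpr (ZMod.val_lt i), ZMod.natCast_zmod_val i⟩
  · intro _ _
    rfl

lemma gp_sum_shift {α : Type*} [AddCommMonoid α] (N : ℕ) [NeZero N] (f : ZMod N → α) :
    ∑ i, f (i + 1) = ∑ i, f i :=
  Equiv.sum_comp (Equiv.addRight (1 : ZMod N)) f

lemma gp_sum_translate {α : Type*} [AddCommMonoid α] (N : ℕ) [NeZero N] (f : ZMod N → α)
    (j : ZMod N) : ∑ i, f (j + i) = ∑ i, f i :=
  Equiv.sum_comp (Equiv.addLeft j) f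

lemma gp_path {E : Type*} [NormedAddCommGroup E] (N : ℕ) [NeZero N] (X : ZMod N → E)
    (i j : ZMod N) : ‖X i - X j‖ ≤ ∑ l, ‖X (l + 1) - X l‖ := by
  have h1 : ∀ m : ℕ, ‖X (j + m) - X j‖ ≤
      ∑ l ∈ Finset.range m, ‖X (j + l + 1) - X (j + l)‖ := by
    intro m
    induction m with
    | zero => simp
    | succ m ih =>
      rw [Finset.sum_range_succ]
      have : X (j + (m + 1 : ℕ)) - X j = (X (j + m) - X j) + (X (j + m + 1) - X (j + m)) := by
        push_cast
        rw [add_assoc]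
        abel
      rw [this]
      exact (norm_add_le _ _).trans (by gcongr)
  have h2 := h1 (i - j).val
  rw [ZMod.natCast_zmod_val, add_sub_cancel] at h2
  refine h2.trans ?_
  have h3 : ∑ l ∈ Finset.range (i - j).val, ‖X (j + l + 1) - X (j + l)‖ ≤
      ∑ l ∈ Finset.range N, ‖X (j + l + 1) - X (j + l)‖ := by
    refine Finset.sum_le_sum_of_subset_of_nonneg ?_ (fun _ _ _ => norm_nonneg _)
    exact Finset.range_subset_range.mpr (ZMod.val_lt _).le
  refine h3.trans ?_
  rw [gp_sum_range N (fun l => ‖X (j + l + 1) - X (j + l)‖),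
    gp_sum_translate N (fun l => ‖X (l + 1) - X l‖) j]

lemma gp_per {α : Type*} (N : ℕ) [NeZero N] (f : ℝ → α) (h : ℝ)
    (hf : Function.Periodic f (N * h)) (i : ℤ) :
    f (((i : ZMod N).val : ℝ) * h) = f (i * h) := by
  have h1 : (((i : ZMod N).val : ℤ)) = i % N := ZMod.val_intCast i
  have h2 := Int.emod_add_mul_ediv i N
  have h3 : (i : ℝ) * h = ((i : ZMod N).val : ℝ) * h + (i / (N : ℤ) : ℤ) * (N * h) := by
    have h4 : (((i : ZMod N).val : ℝ)) = ((i % N : ℤ) : ℝ) := by rw [← h1]; simp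
    rw [h4]
    have h5 : (i : ℝ) = ((i % N : ℤ) : ℝ) + N * (i / (N : ℤ) : ℤ) := by exact_mod_cast h2.symm
    nth_rw 1 [h5]
    ring
  rw [h3]
  exact ((hf.int_mul (i / (N : ℤ))) _).symm

/-! ### The discrete dual action -/

section Discrete

variable {E : Type*} [NormedAddCommGroup E] [InnerProductSpace ℝ E]

/-- The symmetric bilinear form (up to a factor, the discrete symplectic area). -/
noncomputable def gpB (J : E →L[ℝ] E) (N : ℕ) [NeZero N] (V X : ZMod N → E) : ℝ :=
  ∑ i, ⟪J (V (i + 1) - V i), X i + X (i + 1)⟫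

/-- The discrete dual velocity `-J (X (i+1) - X i) / h`. -/
noncomputable def gpU (J : E →L[ℝ] E) (N : ℕ) (h : ℝ) (X : ZMod N → E) (i : ZMod N) : E :=
  -(h⁻¹ • J (X (i + 1) - X i))

/-- The discrete dual action functional. -/
noncomputable def gpPhi (J : E →L[ℝ] E) (N : ℕ) [NeZero N] (h : ℝ) (L : ZMod N → E → ℝ)
    (X : ZMod N → E) : ℝ :=
  h * ∑ i, L i (gpU J N h X i) + 1 / 4 * gpB J N X X

lemma gp_J_norm (J : E →L[ℝ] E) (hJ : ∀ x, J (J x) = -x) (hJs : ∀ x y, ⟪J x, y⟫ = -⟪x, J y⟫)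
    (x : E) : ‖J x‖ = ‖x‖ := by
  have : ‖J x‖ ^ 2 = ‖x‖ ^ 2 := by
    rw [← real_inner_self_eq_norm_sq, ← real_inner_self_eq_norm_sq, hJs, hJ, inner_neg_right,
      neg_neg]
  exact (pow_left_inj₀ (norm_nonneg _) (norm_nonneg _) two_ne_zero).mp this

lemma gp_J_self (J : E →L[ℝ] E) (hJs : ∀ x y, ⟪J x, y⟫ = -⟪x, J y⟫)
    (x : E) : ⟪J x, x⟫ = 0 := by
  have h1 := hJs x x
  rw [real_inner_comm] at h1
  rw [real_inner_comm]
  linarith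

lemma gpB_symm (J : E →L[ℝ] E) (hJs : ∀ x y, ⟪J x, y⟫ = -⟪x, J y⟫)
    (N : ℕ) [NeZero N] (V X : ZMod N → E) : gpB J N V X = gpB J N X V := by
  unfold gpB
  have h1 := gp_sum_shift N (fun i => ⟪J (V i), X i⟫)
  have h2 := gp_sum_shift N (fun i => ⟪J (X i), V i⟫)
  rw [← sub_eq_zero, ← Finset.sum_sub_distrib] at h1 h2 ⊢
  have : ∀ i, ⟪J (V (i + 1) - V i), X i + X (i + 1)⟫ - ⟪J (X (i + 1) - X i), V i + V (i + 1)⟫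
      = (⟪J (V (i + 1)), X (i + 1)⟫ - ⟪J (V i), X i⟫)
        - (⟪J (X (i + 1)), V (i + 1)⟫ - ⟪J (X i), V i⟫) := by
    intro i
    have a1 := hJs (V (i + 1)) (X i)
    have a2 := hJs (V i) (X (i + 1))
    rw [real_inner_comm] at a1 a2
    have a3 := real_inner_comm (V (i + 1)) (J (X i))
    have a4 := real_inner_comm (V i) (J (X (i + 1)))
    have a5 := real_inner_comm (X i) (J (V (i + 1)))
    have a6 := real_inner_comm (X (i + 1)) (J (V i))
    simp only [map_sub, inner_sub_left, inner_add_right]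
    linarith
  rw [Finset.sum_congr rfl (fun i _ => this i), Finset.sum_sub_distrib]
  linarith

lemma gpB_add_smul (J : E →L[ℝ] E) (hJs : ∀ x y, ⟪J x, y⟫ = -⟪x, J y⟫)
    (N : ℕ) [NeZero N] (X V : ZMod N → E) (s : ℝ) :
    gpB J N (X + s • V) (X + s • V) =
      gpB J N X X + 2 * s * gpB J N V X + s ^ 2 * gpB J N V V := by
  have h1 : gpB J N (X + s • V) (X + s • V) =
      gpB J N X X + s * gpB J N V X + s * gpB J N X V + s ^ 2 * gpB J N V V := by
    unfold gpB
    rw [Finset.mul_sum, Finset.mul_sum, Finset.mul_sum, ← Finset.sum_add_distrib,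
      ← Finset.sum_add_distrib, ← Finset.sum_add_distrib]
    refine Finset.sum_congr rfl (fun i _ => ?_)
    simp only [Pi.add_apply, Pi.smul_apply, map_sub, map_add, map_smul, inner_sub_left,
      inner_add_left, inner_add_right, inner_smul_left, inner_smul_right]
    simp
    ring
  rw [h1, gpB_symm J hJs N X V]
  ring

lemma gpU_add_smul (J : E →L[ℝ] E) (N : ℕ) (h : ℝ) (X V : ZMod N → E) (s : ℝ) (i : ZMod N) :
    gpU J N h (X + s • V) i = gpU J N h X i + s • gpU J N h V i := by
  unfold gpU
  simp only [Pi.add_apply, Pi.smul_apply, map_sub, map_add, map_smul]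
  module

lemma gpU_shift (J : E →L[ℝ] E) (N : ℕ) (h : ℝ) (X : ZMod N → E) (w : E) (i : ZMod N) :
    gpU J N h (fun i => X i + w) i = gpU J N h X i := by
  unfold gpU
  simp

lemma gpB_shift_right (J : E →L[ℝ] E) (N : ℕ) [NeZero N] (V X : ZMod N → E) (w : E) :
    gpB J N V (fun i => X i + w) = gpB J N V X := by
  unfold gpB
  have h1 := gp_sum_shift N (fun i => ⟪J (V i), (2 : ℝ) • w⟫)
  rw [← sub_eq_zero, ← Finset.sum_sub_distrib] at h1 ⊢
  rw [← h1]
  refine Finset.sum_congr rfl (fun i _ => ?_)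
  simp only [map_sub, inner_sub_left, inner_add_right, two_smul]
  ring

lemma gpB_shift_left (J : E →L[ℝ] E) (N : ℕ) [NeZero N] (V X : ZMod N → E) (w : E) :
    gpB J N (fun i => V i + w) X = gpB J N V X := by
  unfold gpB
  simp

lemma gpPhi_shift (J : E →L[ℝ] E) (N : ℕ) [NeZero N] (h : ℝ) (L : ZMod N → E → ℝ)
    (X : ZMod N → E) (w : E) :
    gpPhi J N h L (fun i => X i + w) = gpPhi J N h L X := by
  unfold gpPhi
  rw [gpB_shift_right, gpB_shift_left]
  simp only [gpU_shift]

lemma gpB_bound (J : E →L[ℝ] E) (hJ : ∀ x, J (J x) = -x) (hJs : ∀ x y, ⟪J x, y⟫ = -⟪x, J y⟫)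
    (N : ℕ) [NeZero N] (X : ZMod N → E) :
    |gpB J N X X| ≤ 2 * (∑ l, ‖X (l + 1) - X l‖) ^ 2 := by
  set S := ∑ l, ‖X (l + 1) - X l‖ with hS
  rw [← gpB_shift_right J N X X (-X 0)]
  unfold gpB
  refine (Finset.abs_sum_le_sum_abs _ _).trans ?_
  have : 2 * S ^ 2 = ∑ l, ‖X (l + 1) - X l‖ * (2 * S) := by
    rw [← Finset.sum_mul, ← hS]; ring
  rw [this]
  refine Finset.sum_le_sum (fun i _ => ?_)
  refine (abs_real_inner_le_norm _ _).trans ?_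
  rw [gp_J_norm J hJ hJs]
  refine mul_le_mul_of_nonneg_left ?_ (norm_nonneg _)
  refine (norm_add_le _ _).trans ?_
  have h1 := gp_path N X i 0
  have h2 := gp_path N X (i + 1) 0
  show ‖X i + -X 0‖ + ‖X (i + 1) + -X 0‖ ≤ 2 * S
  rw [← sub_eq_add_neg, ← sub_eq_add_neg]
  linarith

lemma gpPhi_lower (J : E →L[ℝ] E) (hJ : ∀ x, J (J x) = -x) (hJs : ∀ x y, ⟪J x, y⟫ = -⟪x, J y⟫)
    (N : ℕ) [NeZero N] (h : ℝ) (hh : 0 < h) (L : ZMod N → E → ℝ) (c : ℝ)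
    (hL : ∀ i u, N * h * ‖u‖ ^ 2 - c ≤ L i u) (X : ZMod N → E) :
    1 / 2 * (∑ l, ‖X (l + 1) - X l‖) ^ 2 - c * (N * h) ≤ gpPhi J N h L X := by
  have h1 := gpB_bound J hJ hJs N X
  set S := ∑ l, ‖X (l + 1) - X l‖ with hS
  have h2 : S ^ 2 ≤ N * ∑ l, ‖X (l + 1) - X l‖ ^ 2 := by
    have := sq_sum_le_card_mul_sum_sq (s := (Finset.univ : Finset (ZMod N)))
      (f := fun l => ‖X (l + 1) - X l‖)
    simpa [ZMod.card] using this
  have h3 : N * ∑ l, ‖X (l + 1) - X l‖ ^ 2 - c * (N * h) ≤ h * ∑ i, L i (gpU J N h X i) := by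
    have : N * ∑ l, ‖X (l + 1) - X l‖ ^ 2 - c * (N * h)
        = h * ∑ i, (N * h * ‖gpU J N h X i‖ ^ 2 - c) := by
      rw [Finset.sum_sub_distrib, ← Finset.mul_sum]
      have h4 : ∀ i, ‖gpU J N h X i‖ ^ 2 = (h⁻¹) ^ 2 * ‖X (i + 1) - X i‖ ^ 2 := by
        intro i
        unfold gpU
        rw [norm_neg, norm_smul, gp_J_norm J hJ hJs, Real.norm_eq_abs, mul_pow, sq_abs]
      rw [Finset.sum_congr rfl (fun i _ => h4 i), ← Finset.mul_sum]
      simp [ZMod.card]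
      field_simp
    rw [this]
    exact mul_le_mul_of_nonneg_left (Finset.sum_le_sum (fun i _ => hL i _)) hh.le
  unfold gpPhi
  rw [abs_le] at h1
  linarith [h1.1]

lemma gpPhi_exists_min [FiniteDimensional ℝ E]
    (J : E →L[ℝ] E) (hJ : ∀ x, J (J x) = -x) (hJs : ∀ x y, ⟪J x, y⟫ = -⟪x, J y⟫)
    (N : ℕ) [NeZero N] (h : ℝ) (hh : 0 < h) (L : ZMod N → E → ℝ) (c : ℝ)
    (hLc : ∀ i, Continuous (L i))
    (hL : ∀ i u, N * h * ‖u‖ ^ 2 - c ≤ L i u) :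
    ∃ X : ZMod N → E, ∀ Y, gpPhi J N h L X ≤ gpPhi J N h L Y := by
  have hcont : Continuous (gpPhi J N h L) := by
    unfold gpPhi gpB gpU
    have := fun i => hLc i
    fun_prop
  have hclosed : IsClosed {X : ZMod N → E | X 0 = 0} :=
    isClosed_eq (continuous_apply 0) continuous_const
  have hev : ∀ᶠ X in cocompact (ZMod N → E) ⊓ 𝓟 {X : ZMod N → E | X 0 = 0},
      gpPhi J N h L 0 ≤ gpPhi J N h L X := by
    rw [eventually_inf_principal]
    have ht : Tendsto (fun X : ZMod N → E => 1 / 2 * ‖X‖ ^ 2 + -(c * (N * h)))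
        (cocompact (ZMod N → E)) atTop := by
      refine tendsto_atTop_add_const_right _ _ ?_
      refine Tendsto.const_mul_atTop (by norm_num) ?_
      exact (tendsto_pow_atTop two_ne_zero).comp tendsto_norm_cocompact_atTop
    filter_upwards [ht.eventually_ge_atTop (gpPhi J N h L 0)] with X hX hX0
    refine hX.trans ?_
    refine le_trans ?_ (gpPhi_lower J hJ hJs N h hh L c hL X)
    have : ‖X‖ ≤ ∑ l, ‖X (l + 1) - X l‖ := by
      rw [pi_norm_le_iff_of_nonneg (Finset.sum_nonneg (fun _ _ => norm_nonneg _))]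
      intro i
      have := gp_path N X i 0
      rw [show X 0 = 0 from hX0, sub_zero] at this
      exact this
    have := pow_le_pow_left₀ (norm_nonneg X) this 2
    linarith
  obtain ⟨X, hX0, hX⟩ := hcont.continuousOn.exists_isMinOn' hclosed
    (x₀ := 0) (by simp) hev
  refine ⟨X, fun Y => ?_⟩
  rw [← gpPhi_shift J N h L Y (-Y 0)]
  exact hX (by simp)

lemma gp_euler_lagrange
    (J : E →L[ℝ] E) (hJ : ∀ x, J (J x) = -x) (hJs : ∀ x y, ⟪J x, y⟫ = -⟪x, J y⟫)
    (N : ℕ) [NeZero N] (h : ℝ) (hh : 0 < h) (L K : ZMod N → E → ℝ) (Z : ZMod N → E → E)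
    (hZ : ∀ i, Continuous (Z i)) (hLZ : ∀ i u, L i u = ⟪u, Z i u⟫ - K i (Z i u))
    (hLK : ∀ i u w, ⟪u, w⟫ - K i w ≤ L i u)
    (X : ZMod N → E) (hX : ∀ Y, gpPhi J N h L X ≤ gpPhi J N h L Y) :
    ∃ w : E, ∀ i, Z i (gpU J N h X i) = (1 / 2 : ℝ) • (X i + X (i + 1)) + w := by
  have step1 : ∀ V : ZMod N → E,
      0 ≤ h * ∑ i, ⟪gpU J N h V i, Z i (gpU J N h X i)⟫ + 1 / 2 * gpB J N V X := by
    intro V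
    have hs : ∀ s : ℝ, 0 < s → 0 ≤ h * ∑ i, ⟪gpU J N h V i,
        Z i (gpU J N h X i + s • gpU J N h V i)⟫ + 1 / 2 * gpB J N V X
          + s / 4 * gpB J N V V := by
      intro s hs
      have h1 := hX (X + s • V)
      unfold gpPhi at h1
      rw [gpB_add_smul J hJs] at h1
      have h2 : ∑ i, L i (gpU J N h (X + s • V) i) ≤ ∑ i, L i (gpU J N h X i) +
          s * ∑ i, ⟪gpU J N h V i, Z i (gpU J N h X i + s • gpU J N h V i)⟫ := by
        rw [Finset.mul_sum, ← Finset.sum_add_distrib]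
        refine Finset.sum_le_sum (fun i _ => ?_)
        rw [gpU_add_smul, hLZ]
        have := hLK i (gpU J N h X i) (Z i (gpU J N h X i + s • gpU J N h V i))
        rw [inner_add_left, inner_smul_left]
        simp only [conj_trivial]
        linarith
      have h3 := mul_le_mul_of_nonneg_left h2 hh.le
      have h4 : 0 ≤ s * (h * ∑ i, ⟪gpU J N h V i,
        Z i (gpU J N h X i + s • gpU J N h V i)⟫ + 1 / 2 * gpB J N V X
          + s / 4 * gpB J N V V) := by
        linarith
      exact nonneg_of_mul_nonneg_right h4 hs
    have hc : Continuous (fun s : ℝ => h * ∑ i, ⟪gpU J N h V i,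
        Z i (gpU J N h X i + s • gpU J N h V i)⟫ + 1 / 2 * gpB J N V X
          + s / 4 * gpB J N V V) := by
      have := fun i => hZ i
      fun_prop
    have ht : Tendsto (fun s : ℝ => h * ∑ i, ⟪gpU J N h V i,
        Z i (gpU J N h X i + s • gpU J N h V i)⟫ + 1 / 2 * gpB J N V X
          + s / 4 * gpB J N V V) (nhdsWithin 0 (Set.Ioi 0)) (nhds (h * ∑ i, ⟪gpU J N h V i,
        Z i (gpU J N h X i + (0 : ℝ) • gpU J N h V i)⟫ + 1 / 2 * gpB J N V X
          + (0 : ℝ) / 4 * gpB J N V V)) := (hc.tendsto 0).mono_left nhdsWithin_le_nhds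
    have h0 := ge_of_tendsto ht (by
      filter_upwards [self_mem_nhdsWithin] with s hs' using hs s hs')
    simpa using h0
  set w : ZMod N → E := fun i => Z i (gpU J N h X i) - (1 / 2 : ℝ) • (X i + X (i + 1)) with hw
  have step2 : ∀ V : ZMod N → E, 0 ≤ ∑ i, ⟪V (i + 1), J (w i) - J (w (i + 1))⟫ := by
    intro V
    have h1 := step1 V
    have h2 : h * ∑ i, ⟪gpU J N h V i, Z i (gpU J N h X i)⟫ + 1 / 2 * gpB J N V X
        = ∑ i, ⟪V (i + 1) - V i, J (w i)⟫ := by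
      unfold gpB
      rw [Finset.mul_sum, Finset.mul_sum, ← Finset.sum_add_distrib]
      refine Finset.sum_congr rfl (fun i _ => ?_)
      have h3 := hJs (V (i + 1) - V i) (w i)
      have h4 : ⟪V (i + 1) - V i, J (w i)⟫ = - ⟪J (V (i + 1) - V i), w i⟫ := by linarith
      rw [h4, hw]
      simp only [gpU, inner_neg_left, inner_smul_left, inner_sub_right, inner_smul_right,
        conj_trivial]
      field_simp
      ring
    rw [h2] at h1
    have h3 := gp_sum_shift N (fun i => ⟪V i, J (w i)⟫)
    have h4 : ∑ i, ⟪V (i + 1), J (w i) - J (w (i + 1))⟫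
        = ∑ i, ⟪V (i + 1) - V i, J (w i)⟫ := by
      simp only [inner_sub_right, inner_sub_left, Finset.sum_sub_distrib]
      linarith
    rw [h4]
    exact h1
  have step3 : ∑ i, ‖w (i + 1) - w i‖ ^ 2 ≤ 0 := by
    have h1 := step2 (fun i => J (w i) - J (w (i - 1)))
    have h2 : ∀ i, ⟪J (w (i + 1)) - J (w (i + 1 - 1)), J (w i) - J (w (i + 1))⟫
        = - ‖w (i + 1) - w i‖ ^ 2 := by
      intro i
      rw [add_sub_cancel_right, ← neg_sub (J (w (i + 1))) (J (w i)), inner_neg_right,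
        real_inner_self_eq_norm_sq, ← map_sub, gp_J_norm J hJ hJs]
    rw [Finset.sum_congr rfl (fun i _ => h2 i), Finset.sum_neg_distrib] at h1
    linarith
  have step4 : ∀ i, ‖w (i + 1) - w i‖ = 0 := by
    intro i
    have h1 := (Finset.sum_eq_zero_iff_of_nonneg (fun i _ => sq_nonneg ‖w (i + 1) - w i‖)).mp
      (le_antisymm step3 (Finset.sum_nonneg (fun i _ => sq_nonneg _))) i (Finset.mem_univ i)
    exact pow_eq_zero_iff two_ne_zero |>.mp h1
  refine ⟨w 0, fun i => ?_⟩
  have h5 := gp_path N w i 0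
  rw [Finset.sum_eq_zero (fun i _ => step4 i)] at h5
  have h6 : w i = w 0 := sub_eq_zero.mp (norm_le_zero_iff.mp h5)
  rw [← h6, hw]
  simp

lemma gp_test (J : E →L[ℝ] E) (hJ : ∀ x, J (J x) = -x) (hJs : ∀ x y, ⟪J x, y⟫ = -⟪x, J y⟫)
    (N : ℕ) [NeZero N] (hN : 4 ≤ N) (h : ℝ) (hh : 0 < h) (L : ZMod N → E → ℝ) (C : ℝ)
    (hL : ∀ i u, ‖u‖ ≤ 1 → L i u ≤ C) (ξ : E) (hξ : ‖ξ‖ = 1) :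
    ∃ X : ZMod N → E, gpPhi J N h L X ≤ C * (N * h) - (N * h) ^ 2 / (2 * π ^ 2) := by
  have hN0 : (0 : ℝ) < N := by exact_mod_cast (by omega : 0 < N)
  have hN4 : (4 : ℝ) ≤ N := by exact_mod_cast hN
  set θ : ℝ := 2 * π / N with hθ
  have hθN : N * θ = 2 * π := by rw [hθ]; field_simp
  have hπ := Real.pi_pos
  have hθ0 : 0 < θ := by positivity
  have hθ1 : θ ≤ π / 2 := by nlinarith
  set a : ℝ := N * h / (2 * π) with ha
  have ha0 : 0 < a := by positivity
  have haθ : a * θ = h := by rw [ha, hθ]; field_simp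
  let γ : ℝ → E := fun s => Real.cos s • ξ + Real.sin s • J ξ
  have hγper : Function.Periodic γ (N * θ) := by
    intro s
    simp only [γ, hθN, Real.cos_add_two_pi, Real.sin_add_two_pi]
  let X : ZMod N → E := fun i => a • γ ((i.val : ℝ) * θ)
  have hX1 : ∀ i : ZMod N, X (i + 1) = a • γ ((i.val : ℝ) * θ + θ) := by
    intro i
    have h1 := gp_per N γ θ hγper ((i.val : ℤ) + 1)
    have h2 : (((i.val : ℤ) + 1 : ℤ) : ZMod N) = i + 1 := by
      push_cast
      rw [ZMod.natCast_zmod_val]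
    rw [h2] at h1
    simp only [X]
    rw [h1]
    push_cast
    rw [add_mul, one_mul]
  have i1 : ⟪ξ, ξ⟫ = 1 := by rw [real_inner_self_eq_norm_sq, hξ]; norm_num
  have i2 : ⟪J ξ, ξ⟫ = 0 := gp_J_self J hJs ξ
  have i3 : ⟪ξ, J ξ⟫ = 0 := by rw [real_inner_comm]; exact i2
  have i4 : ⟪J ξ, J ξ⟫ = 1 := by
    rw [real_inner_self_eq_norm_sq, gp_J_norm J hJ hJs, hξ]; norm_num
  have hJγ : ∀ s, J (γ s) = Real.cos s • J ξ - Real.sin s • ξ := by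
    intro s
    simp only [γ, map_add, map_smul, hJ, smul_neg, sub_eq_add_neg]
  have hγγ : ∀ s r, ⟪γ s, γ r⟫ = Real.cos (s - r) := by
    intro s r
    simp only [γ, inner_add_left, inner_add_right, inner_smul_left, inner_smul_right, i1, i2, i3,
      i4, conj_trivial, Real.cos_sub]
    ring
  have hγn : ∀ s, ‖γ s‖ ^ 2 = 1 := by
    intro s
    rw [← real_inner_self_eq_norm_sq, hγγ, sub_self, Real.cos_zero]
  have hJγγ : ∀ s r, ⟪J (γ s), γ r⟫ = - Real.sin (s - r) := by
    intro s r
    rw [hJγ]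
    simp only [γ, inner_sub_left, inner_add_right, inner_smul_left, inner_smul_right, i1, i2, i3,
      i4, conj_trivial, Real.sin_sub]
    ring
  have hB : gpB J N X X = - (2 * N * a ^ 2 * Real.sin θ) := by
    unfold gpB
    have : ∀ i : ZMod N, ⟪J (X (i + 1) - X i), X i + X (i + 1)⟫ = -(2 * a ^ 2 * Real.sin θ) := by
      intro i
      rw [hX1]
      simp only [X, map_sub, map_smul, inner_sub_left, inner_add_right, inner_smul_left,
        inner_smul_right, hJγγ, conj_trivial]
      simp
      ring
    rw [Finset.sum_congr rfl (fun i _ => this i)]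
    simp [ZMod.card]
    ring
  have hU : ∀ i, ‖gpU J N h X i‖ ≤ 1 := by
    intro i
    have h1 : ‖X (i + 1) - X i‖ ^ 2 ≤ h ^ 2 := by
      rw [hX1]
      simp only [X]
      rw [← smul_sub, norm_smul, mul_pow, norm_sub_sq_real, hγn, hγn, hγγ, ← haθ]
      have := Real.one_sub_sq_div_two_le_cos (x := θ)
      simp only [add_sub_cancel_left, Real.norm_eq_abs, sq_abs, mul_pow]
      refine mul_le_mul_of_nonneg_left ?_ (sq_nonneg a)
      linarith
    have h2 : ‖X (i + 1) - X i‖ ≤ h := le_of_sq_le_sq h1 hh.le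
    unfold gpU
    rw [norm_neg, norm_smul, gp_J_norm J hJ hJs, norm_inv, Real.norm_eq_abs, abs_of_pos hh,
      inv_mul_le_iff₀ hh, mul_one]
    exact h2
  refine ⟨X, ?_⟩
  unfold gpPhi
  have hsum : ∑ i, L i (gpU J N h X i) ≤ N * C := by
    have : ∑ i, L i (gpU J N h X i) ≤ ∑ _i : ZMod N, C :=
      Finset.sum_le_sum (fun i _ => hL i _ (hU i))
    simpa [ZMod.card] using this
  have h1 := mul_le_mul_of_nonneg_left hsum hh.le
  rw [hB]
  have h2 := Real.mul_le_sin hθ0.le hθ1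
  have h3 : 2 / π * θ = 4 / N := by rw [hθ]; field_simp; ring
  rw [h3] at h2
  have h4 : (2 * N * a ^ 2) * (4 / N) ≤ 2 * N * a ^ 2 * Real.sin θ :=
    mul_le_mul_of_nonneg_left h2 (by positivity)
  have h5 : (2 * N * a ^ 2) * (4 / N) = 4 * ((N * h) ^ 2 / (2 * π ^ 2)) := by
    rw [ha]; field_simp
  rw [h5] at h4
  linarith

end Discrete

lemma gp_discrete {E : Type*} [NormedAddCommGroup E] [InnerProductSpace ℝ E]
    [FiniteDimensional ℝ E]
    (J : E →L[ℝ] E) (hJ : ∀ x, J (J x) = -x) (hJs : ∀ x y, ⟪J x, y⟫ = -⟪x, J y⟫)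
    (N : ℕ) [NeZero N] (hN : 4 ≤ N) (h : ℝ) (hh : 0 < h)
    (K : ZMod N → E → ℝ) (G : ZMod N → E → E) (hG : ∀ i, Continuous (G i))
    (hgrad : ∀ i x, HasGradientAt (K i) (G i x) x)
    (hineq : ∀ i x y, K i x + ⟪G i x, y - x⟫ ≤ K i y)
    (hinj : ∀ i, Function.Injective (G i))
    (hcoer : ∀ i, ∀ κ : ℝ, ∃ C : ℝ, ∀ x, κ * ‖x‖ - C ≤ K i x)
    (c C : ℝ) (hc : ∀ i x, K i x ≤ 1 / (4 * (N * h)) * ‖x‖ ^ 2 + c)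
    (hC : ∀ i x, ‖x‖ - C ≤ K i x) (ξ : E) (hξ : ‖ξ‖ = 1) :
    ∃ X : ZMod N → E,
      (∀ i, X (i + 1) - X i = h • J (G i ((1 / 2 : ℝ) • (X i + X (i + 1))))) ∧
      (∀ i, ‖X i‖ ≤ c + C + √(2 * (C + c) * (N * h))) ∧
      h * ∑ i, (1 / 2 * ⟪G i ((1 / 2 : ℝ) • (X i + X (i + 1))), (1 / 2 : ℝ) • (X i + X (i + 1))⟫
        - K i ((1 / 2 : ℝ) • (X i + X (i + 1)))) ≤
        C * (N * h) - (N * h) ^ 2 / (2 * π ^ 2) := by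
  have hN0 : (0 : ℝ) < N := by exact_mod_cast (by omega : 0 < N)
  have hτ : 0 < N * h := by positivity
  choose Z L hZ hLc hGZ hLZ hLK using fun i =>
    gp_dual (K i) (G i) (hG i) (hgrad i) (hineq i) (hinj i) (hcoer i)
  have hLlow : ∀ i u, N * h * ‖u‖ ^ 2 - c ≤ L i u := by
    intro i u
    have h1 := hLK i u ((2 * (N * h)) • u)
    have h2 := hc i ((2 * (N * h)) • u)
    rw [inner_smul_right, real_inner_self_eq_norm_sq] at h1
    rw [norm_smul, mul_pow, Real.norm_eq_abs, sq_abs] at h2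
    have h3 : 1 / (4 * (N * h)) * ((2 * (N * h)) ^ 2 * ‖u‖ ^ 2) = N * h * ‖u‖ ^ 2 := by
      field_simp
      ring
    rw [h3] at h2
    linarith
  have hLup : ∀ i u, ‖u‖ ≤ 1 → L i u ≤ C := by
    intro i u hu
    rw [hLZ]
    have h1 := hC i (Z i u)
    have h2 := real_inner_le_norm u (Z i u)
    have h3 := mul_le_mul_of_nonneg_right hu (norm_nonneg (Z i u))
    linarith
  obtain ⟨X₀, hX₀⟩ := gpPhi_exists_min J hJ hJs N h hh L c hLc hLlow
  obtain ⟨w, hw⟩ := gp_euler_lagrange J hJ hJs N h hh L K Z hZ hLZ hLK X₀ hX₀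
  obtain ⟨Xt, hXt⟩ := gp_test J hJ hJs N hN h hh L C hLup ξ hξ
  set X : ZMod N → E := fun i => X₀ i + w with hXdef
  have hPhi : gpPhi J N h L X ≤ C * (N * h) - (N * h) ^ 2 / (2 * π ^ 2) := by
    rw [hXdef, gpPhi_shift]
    exact (hX₀ Xt).trans hXt
  have hlow := gpPhi_lower J hJ hJs N h hh L c hLlow X
  have hBb := gpB_bound J hJ hJs N X
  have hpath := gp_path N X
  set S := ∑ l, ‖X (l + 1) - X l‖ with hS
  have hS0 : 0 ≤ S := Finset.sum_nonneg (fun _ _ => norm_nonneg _)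
  set m : ZMod N → E := fun i => (1 / 2 : ℝ) • (X i + X (i + 1)) with hm
  have hZm : ∀ i, Z i (gpU J N h X i) = m i := by
    intro i
    rw [hXdef, gpU_shift, hw, hm]
    simp only [hXdef]
    module
  have hGm : ∀ i, G i (m i) = gpU J N h X i := by
    intro i
    rw [← hZm, hGZ]
  have heq : ∀ i, X (i + 1) - X i = h • J (G i (m i)) := by
    intro i
    rw [hGm, gpU, map_neg, map_smul, hJ]
    simp only [smul_neg, neg_neg]
    rw [smul_smul, mul_inv_cancel₀ hh.ne', one_smul]
  have hBm : gpB J N X X = - (2 * h * ∑ i, ⟪G i (m i), m i⟫) := by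
    unfold gpB
    rw [Finset.mul_sum, ← Finset.sum_neg_distrib]
    refine Finset.sum_congr rfl (fun i _ => ?_)
    rw [hGm, gpU, hm]
    simp only [inner_neg_left, inner_smul_left, inner_smul_right, conj_trivial]
    field_simp
  have hact : gpPhi J N h L X = h * ∑ i, (1 / 2 * ⟪G i (m i), m i⟫ - K i (m i)) := by
    unfold gpPhi
    have h1 : ∀ i, L i (gpU J N h X i) = ⟪G i (m i), m i⟫ - K i (m i) := by
      intro i
      rw [hLZ, hZm, hGm]
    rw [Finset.sum_congr rfl (fun i _ => h1 i), hBm]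
    simp only [Finset.sum_sub_distrib, ← Finset.mul_sum]
    ring
  refine ⟨X, heq, ?_, ?_⟩
  · have hS2 : S ^ 2 ≤ 2 * (C + c) * (N * h) := by
      have : 0 ≤ (N * h) ^ 2 / (2 * π ^ 2) := by positivity
      linarith
    have hSs : S ≤ √(2 * (C + c) * (N * h)) := Real.le_sqrt_of_sq_le hS2
    have hKsum : ∑ i, K i (m i) ≤ ∑ _i : ZMod N, c := by
      have h1 : h * ∑ i, K i (m i) ≤ h * (N * c) := by
        simp only [Finset.sum_sub_distrib, ← Finset.mul_sum] at hact
        rw [abs_le] at hBb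
        linarith [hBb.1]
      have h2 := le_of_mul_le_mul_left h1 hh
      simpa [ZMod.card] using h2
    obtain ⟨i, _, hi⟩ := Finset.exists_le_of_sum_le (Finset.univ_nonempty) hKsum
    have hmi : ‖m i‖ ≤ c + C := by linarith [hC i (m i)]
    intro j
    have h1 : X j = m i + ((1 / 2 : ℝ) • (X j - X i) + (1 / 2 : ℝ) • (X j - X (i + 1))) := by
      rw [hm]; module
    rw [h1]
    refine (norm_add_le _ _).trans (add_le_add hmi ((norm_add_le _ _).trans ?_))
    rw [norm_smul, norm_smul]
    have h2 := hpath j i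
    have h3 := hpath j (i + 1)
    norm_num
    linarith
  · exact hact ▸ hPhi

/-! ### From the discrete to the continuous problem -/

lemma gp_primitive {V : Type*} [AddCommGroup V] (f : ℤ → V) :
    ∃ A : ℤ → V, A 0 = 0 ∧ ∀ i, A (i + 1) - A i = f i := by
  refine ⟨fun i => ∑ l ∈ Finset.Ico 0 i, f l - ∑ l ∈ Finset.Ico i 0, f l, by simp, fun i => ?_⟩
  rcases le_or_gt 0 i with hi | hi
  · have h1 : Finset.Ico 0 (i + 1) = insert i (Finset.Ico 0 i) := by
      ext q; simp only [Finset.mem_Ico, Finset.mem_insert]; omega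
    have h2 : Finset.Ico i 0 = ∅ := by ext q; simp; omega
    have h3 : Finset.Ico (i + 1) 0 = ∅ := by ext q; simp; omega
    simp only [h1, h2, h3]
    rw [Finset.sum_insert (by simp)]
    simp
  · have h1 : Finset.Ico i 0 = insert i (Finset.Ico (i + 1) 0) := by
      ext q; simp only [Finset.mem_Ico, Finset.mem_insert]; omega
    have h2 : Finset.Ico 0 i = ∅ := by ext q; simp; omega
    have h3 : Finset.Ico 0 (i + 1) = ∅ := by ext q; simp; omega
    simp only [h1, h2, h3]
    rw [Finset.sum_insert (by simp)]
    simp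

lemma gp_lip {V : Type*} [NormedAddCommGroup V] [NormedSpace ℝ V]
    (Y f : ℤ → V) (h : ℝ) (hh : 0 ≤ h) (hY : ∀ i, Y (i + 1) - Y i = h • f i) (M : ℝ)
    (hf : ∀ l, ‖f l‖ ≤ M) (i j : ℤ) :
    ‖Y i - Y j‖ ≤ M * (|(i : ℝ) - j| * h) := by
  rcases le_total i j with hij | hij
  · have h1 := gp_sum_bound Y f h hh hY 0 M i j hij (fun l _ _ => by simpa using hf l)
    rw [smul_zero, sub_zero] at h1
    rw [norm_sub_rev, abs_sub_comm, abs_of_nonneg (sub_nonneg.mpr (by exact_mod_cast hij))]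
    exact h1
  · have h1 := gp_sum_bound Y f h hh hY 0 M j i hij (fun l _ _ => by simpa using hf l)
    rw [smul_zero, sub_zero] at h1
    rw [abs_of_nonneg (sub_nonneg.mpr (by exact_mod_cast hij))]
    exact h1

lemma gp_bdd {E V : Type*} [NormedAddCommGroup E] [ProperSpace E] [NormedAddCommGroup V]
    (F : ℝ → E → V) (hF : Continuous (Function.uncurry F)) (τ : ℝ) (hτ : 0 < τ)
    (hper : ∀ x t, F (t + τ) x = F t x) (R : ℝ) :
    ∃ M : ℝ, 0 ≤ M ∧ ∀ t x, ‖x‖ ≤ R → ‖F t x‖ ≤ M := by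
  have hc : IsCompact (Set.Icc 0 τ ×ˢ Metric.closedBall (0 : E) R) :=
    isCompact_Icc.prod (isCompact_closedBall _ _)
  obtain ⟨M, hM⟩ := hc.exists_bound_of_continuousOn hF.continuousOn
  refine ⟨max M 0, le_max_right _ _, fun t x hx => le_max_of_le_left ?_⟩
  have hp : Function.Periodic (fun t => F t x) τ := fun t => hper x t
  obtain ⟨s, hs, hst⟩ := hp.exists_mem_Ico₀ hτ t
  have hst' : F t x = F s x := hst
  rw [hst']
  exact hM (s, x) ⟨⟨hs.1, hs.2.le⟩, by simpa using hx⟩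

lemma gp_ultra {V : Type*} [NormedAddCommGroup V] [ProperSpace V] (U : Ultrafilter ℕ)
    (s : ℕ → V) (M : ℝ) (hs : ∀ j, ‖s j‖ ≤ M) : ∃ v, Tendsto s U (nhds v) := by
  obtain ⟨v, _, hv⟩ := (isCompact_closedBall (0 : V) M).ultrafilter_le_nhds (U.map s) (by
    rw [le_principal_iff]
    show s ⁻¹' _ ∈ (U : Filter ℕ)
    exact Filter.Eventually.of_forall (fun j => by simpa using hs j))
  exact ⟨v, hv⟩

lemma gp_periodic {E : Type*} [NormedAddCommGroup E] [InnerProductSpace ℝ E]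
    [FiniteDimensional ℝ E]
    (J : E →L[ℝ] E) (hJ : ∀ x, J (J x) = -x) (hJs : ∀ x y, ⟪J x, y⟫ = -⟪x, J y⟫)
    (τ : ℝ) (hτ : 0 < τ) (H : ℝ → E → ℝ) (G : ℝ → E → E)
    (hHc : Continuous (Function.uncurry H)) (hGc : Continuous (Function.uncurry G))
    (hHper : ∀ x t, H (t + τ) x = H t x) (hGper : ∀ x t, G (t + τ) x = G t x)
    (hgrad : ∀ t x, HasGradientAt (H t) (G t x) x)
    (hineq : ∀ t x y, H t x + ⟪G t x, y - x⟫ ≤ H t y)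
    (hinj : ∀ t, Function.Injective (G t))
    (hcoer : ∀ κ : ℝ, ∃ C : ℝ, ∀ t x, κ * ‖x‖ - C ≤ H t x)
    (c C : ℝ) (hc : ∀ t x, H t x ≤ 1 / (4 * τ) * ‖x‖ ^ 2 + c)
    (hC : ∀ t x, ‖x‖ - C ≤ H t x) (ξ : E) (hξ : ‖ξ‖ = 1) :
    ∃ (x : ℝ → E) (a : ℝ → ℝ), (∀ t, HasDerivAt x (J (G t (x t))) t) ∧
      (∀ t, x (t + τ) = x t) ∧
      (∀ t, HasDerivAt a (1 / 2 * ⟪G t (x t), x t⟫ - H t (x t)) t) ∧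
      a 0 = 0 ∧ a τ ≤ C * τ - τ ^ 2 / (2 * π ^ 2) := by
  -- step sizes
  set h : ℕ → ℝ := fun j => τ / ((j + 4 : ℕ) : ℝ) with hh
  have hpos : ∀ j, 0 < h j := fun j => by simp only [hh]; positivity
  have hNh : ∀ j, ((j + 4 : ℕ) : ℝ) * h j = τ := fun j => by
    have : (0 : ℝ) < ((j + 4 : ℕ) : ℝ) := by positivity
    simp only [hh]
    field_simp
  have hlim0 : Tendsto h atTop (nhds 0) :=
    (tendsto_const_div_atTop_nhds_zero_nat τ).comp (tendsto_add_atTop_nat 4)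
  have hle : ∀ j, h j ≤ τ := fun j => by
    have h1 := hNh j
    have h2 := hpos j
    push_cast at h1
    nlinarith [mul_nonneg (Nat.cast_nonneg (α := ℝ) j) h2.le]
  -- discrete solutions
  have hdisc := fun j : ℕ => gp_discrete J hJ hJs (j + 4) (by omega) (h j) (hpos j)
    (fun i => H ((i.val : ℝ) * h j)) (fun i => G ((i.val : ℝ) * h j))
    (fun i => hGc.comp (Continuous.prodMk_right _)) (fun i => hgrad _) (fun i => hineq _)
    (fun i => hinj _) (fun i κ => by
      obtain ⟨C, hC⟩ := hcoer κ
      exact ⟨C, hC _⟩) c C (fun i x => by rw [hNh]; exact hc _ _) (fun i => hC _) ξ hξ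
  choose Xd hXeq hXbd hXact using hdisc
  simp only [hNh] at hXbd hXact
  set R := c + C + √(2 * (C + c) * τ) with hR
  let X : ℕ → ℤ → E := fun j i => Xd j (i : ZMod (j + 4))
  let m : ℕ → ℤ → E := fun j i => (1 / 2 : ℝ) • (X j i + X j (i + 1))
  have hXb : ∀ j i, ‖X j i‖ ≤ R := fun j i => hXbd j _
  have hmb : ∀ j i, ‖m j i‖ ≤ R := by
    intro j i
    simp only [m]
    rw [norm_smul]
    have h1 := norm_add_le (X j i) (X j (i + 1))
    have h2 := hXb j i
    have h3 := hXb j (i + 1)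
    norm_num
    linarith
  let F : ℝ → E → E := fun t x => J (G t x)
  let g : ℝ → E → ℝ := fun t x => 1 / 2 * ⟪G t x, x⟫ - H t x
  have hFc : Continuous (Function.uncurry F) := J.continuous.comp hGc
  have hgc : Continuous (Function.uncurry g) := by
    have h1 : Continuous (fun p : ℝ × E => ⟪Function.uncurry G p, p.2⟫) :=
      hGc.inner continuous_snd
    exact (continuous_const.mul h1).sub hHc
  have hFper : ∀ x t, F (t + τ) x = F t x := fun x t => by simp only [F, hGper]
  have hgper : ∀ x t, g (t + τ) x = g t x := fun x t => by simp only [g, hGper, hHper]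
  obtain ⟨M, hM0, hM⟩ := gp_bdd F hFc τ hτ hFper R
  obtain ⟨M', hM'0, hM'⟩ := gp_bdd g hgc τ hτ hgper R
  have hcast : ∀ j (i : ℤ), ((i + 1 : ℤ) : ZMod (j + 4)) = (i : ZMod (j + 4)) + 1 := by
    intro j i; push_cast; rfl
  have hXrec : ∀ j i, X j (i + 1) - X j i = h j • F (i * h j) (m j i) := by
    intro j i
    have h1 := hXeq j (i : ZMod (j + 4))
    have h2 := gp_per (j + 4) (fun t => F t (m j i)) (h j)
      (by rw [hNh]; exact fun t => hFper _ t) i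
    rw [← h2]
    simp only [X, m, F, hcast]
    exact h1
  have hXlip : ∀ j i i', ‖X j i - X j i'‖ ≤ M * (|(i : ℝ) - i'| * h j) := fun j =>
    gp_lip (X j) (fun i => F (i * h j) (m j i)) (h j) (hpos j).le (hXrec j) M
      (fun l => hM _ _ (hmb j l))
  have hmlip : ∀ j i i', ‖m j i - m j i'‖ ≤ M * (|(i : ℝ) - i'| * h j) := by
    intro j i i'
    have h1 := hXlip j i i'
    have h2 := hXlip j (i + 1) (i' + 1)
    push_cast at h2
    rw [add_sub_add_right_eq_sub] at h2
    have h3 : m j i - m j i' = (1 / 2 : ℝ) • ((X j i - X j i') + (X j (i + 1) - X j (i' + 1))) := by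
      simp only [m]; module
    rw [h3, norm_smul]
    have h4 := norm_add_le (X j i - X j i') (X j (i + 1) - X j (i' + 1))
    norm_num
    linarith
  choose A hA0 hArec using fun j => gp_primitive (fun i : ℤ => h j • g (i * h j) (m j i))
  have hAlip : ∀ j i i', ‖A j i - A j i'‖ ≤ M' * (|(i : ℝ) - i'| * h j) := fun j =>
    gp_lip (A j) (fun i => g (i * h j) (m j i)) (h j) (hpos j).le (hArec j) M'
      (fun l => hM' _ _ (hmb j l))
  -- limits along an ultrafilter
  let U : Ultrafilter ℕ := hyperfilter ℕ
  have hU : (U : Filter ℕ) ≤ atTop := Nat.hyperfilter_le_atTop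
  have hlim : Tendsto h U (nhds 0) := hlim0.mono_left hU
  choose x hx using fun t : ℝ => gp_ultra U (fun j => m j ⌊t / h j⌋) R (fun j => hmb j _)
  have hAbd : ∀ t j, ‖A j ⌊t / h j⌋‖ ≤ M' * (|t| + τ) := by
    intro t j
    have h1 := hAlip j ⌊t / h j⌋ 0
    rw [hA0, sub_zero, Int.cast_zero, sub_zero] at h1
    refine h1.trans (mul_le_mul_of_nonneg_left ?_ hM'0)
    rw [← abs_of_pos (hpos j), ← abs_mul, abs_of_pos (hpos j)]
    have h2 := Int.lt_floor_add_one (t / h j)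
    rw [div_lt_iff₀ (hpos j)] at h2
    have h3 := Int.floor_le (t / h j)
    rw [le_div_iff₀ (hpos j)] at h3
    have h4 := hle j
    rw [abs_le]
    constructor
    · nlinarith [neg_abs_le t]
    · nlinarith [le_abs_self t]
  choose a ha using fun t : ℝ => gp_ultra U (fun j => A j ⌊t / h j⌋) _ (hAbd t)
  have hxX : ∀ t, Tendsto (fun j => X j ⌊t / h j⌋) U (nhds (x t)) := by
    intro t
    have h1 : Tendsto (fun j => X j ⌊t / h j⌋ - m j ⌊t / h j⌋) U (nhds 0) := by
      refine squeeze_zero_norm (a := fun j => M * h j) (fun j => ?_) (by simpa using hlim.const_mul M)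
      have h2 := hXlip j ⌊t / h j⌋ (⌊t / h j⌋ + 1)
      have h3 : X j ⌊t / h j⌋ - m j ⌊t / h j⌋ =
          (1 / 2 : ℝ) • (X j ⌊t / h j⌋ - X j (⌊t / h j⌋ + 1)) := by
        simp only [m]; module
      rw [h3, norm_smul]
      push_cast at h2
      rw [sub_add_cancel_left, abs_neg, abs_one, one_mul] at h2
      have h4 := norm_nonneg (X j ⌊t / h j⌋ - X j (⌊t / h j⌋ + 1))
      norm_num
      linarith
    simpa using h1.add (hx t)
  refine ⟨x, a, ?_, ?_, ?_, ?_, ?_⟩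
  · intro t
    exact gp_limit U h hpos hlim F hFc X m hXrec M hM0 hmlip x x hx hxX t
  · intro t
    refine tendsto_nhds_unique (hxX (t + τ)) ?_
    refine (hxX t).congr (fun j => ?_)
    have h1 : (t + τ) / h j = t / h j + ((j + 4 : ℕ) : ℝ) := by
      rw [add_div]
      congr 1
      rw [div_eq_iff (hpos j).ne', hNh]
    simp only [X]
    rw [h1, Int.floor_add_natCast]
    push_cast
    congr 1
    have := ZMod.natCast_self (j + 4)
    push_cast at this
    rw [this, add_zero]
  · intro t
    exact gp_limit U h hpos hlim g hgc A m hArec M hM0 hmlip x a hx ha t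
  · refine tendsto_nhds_unique (ha 0) ?_
    simp [hA0]
  · refine le_of_tendsto (ha τ) (Filter.Eventually.of_forall (fun j => ?_))
    have h1 : τ / h j = ((j + 4 : ℕ) : ℝ) := by rw [div_eq_iff (hpos j).ne', hNh]
    have h2 : ∀ n : ℕ, A j n = ∑ l ∈ Finset.range n, h j • g ((l : ℕ) * h j) (m j (l : ℤ)) := by
      intro n
      induction n with
      | zero => simpa using hA0 j
      | succ n ih =>
        rw [Finset.sum_range_succ, ← ih]
        have := hArec j n
        push_cast at this ⊢
        rw [← this]
        abel
    rw [h1, Int.floor_natCast, h2]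
    refine le_trans (le_of_eq ?_) (hXact j)
    rw [← gp_sum_range, Finset.mul_sum]
    refine Finset.sum_congr rfl (fun l hl => ?_)
    rw [Finset.mem_range] at hl
    rw [ZMod.val_natCast, Nat.mod_eq_of_lt hl]
    simp only [g, m, X, smul_eq_mul]
    push_cast
    rfl

/-! ### Facts about the given Hamiltonian -/

lemma gp_symplectic_sq (n : ℕ) : symplecticJ n * symplecticJ n = -1 := by
  unfold symplecticJ
  rw [Matrix.reindex_apply, Matrix.submatrix_mul_equiv, Matrix.fromBlocks_multiply]
  have h : (Matrix.fromBlocks (0 * 0 + 1 * (-1)) (0 * 1 + 1 * 0) ((-1) * 0 + 0 * (-1))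
      ((-1) * 1 + 0 * 0) : Matrix (Fin n ⊕ Fin n) (Fin n ⊕ Fin n) ℝ) = -1 := by
    rw [← Matrix.fromBlocks_one, Matrix.fromBlocks_neg]
    simp
  rw [h]
  ext i j
  simp [Matrix.one_apply]

lemma gp_symplectic_transpose (n : ℕ) : (symplecticJ n).transpose = -symplecticJ n := by
  unfold symplecticJ
  rw [Matrix.reindex_apply, Matrix.transpose_submatrix, Matrix.fromBlocks_transpose]
  have h : (Matrix.fromBlocks (Matrix.transpose 0) (Matrix.transpose (-1))
      (Matrix.transpose 1) (Matrix.transpose 0) :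
      Matrix (Fin n ⊕ Fin n) (Fin n ⊕ Fin n) ℝ) = -Matrix.fromBlocks 0 1 (-1) 0 := by
    rw [Matrix.fromBlocks_neg]
    simp
  rw [h]
  rfl

lemma gp_injective {m : ℕ} (K : EuclideanSpace ℝ (Fin m) → ℝ) (hK : ContDiff ℝ 2 K)
    (hpos : ∀ x, (hessianMatrix K x).PosDef) : Function.Injective (gradient K) := by
  have hquad : ∀ x v : EuclideanSpace ℝ (Fin m), v ≠ 0 →
      0 < fderiv ℝ (fderiv ℝ K) x v v := by
    intro x v hv
    have hv' : (v.ofLp : Fin m → ℝ) ≠ 0 := by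
      intro h0
      apply hv
      ext i
      simpa using congrFun h0 i
    have h1 := (hpos x).dotProduct_mulVec_pos hv'
    have h2 : v = ∑ i, v.ofLp i • EuclideanSpace.single i (1 : ℝ) := by
      ext j
      simp [Finset.sum_apply, Pi.single_apply]
    have h3 : fderiv ℝ (fderiv ℝ K) x v v = star v.ofLp ⬝ᵥ (hessianMatrix K x).mulVec v.ofLp := by
      conv_lhs => rw [h2]
      simp only [map_sum, map_smul, ContinuousLinearMap.sum_apply, ContinuousLinearMap.smul_apply,
        smul_eq_mul, dotProduct, Matrix.mulVec, hessianMatrix, Matrix.of_apply,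
        iteratedFDeriv_two_apply, Pi.star_apply, star_trivial, Matrix.cons_val_zero,
        Matrix.cons_val_one]
      simp only [Finset.mul_sum]
      rw [Finset.sum_comm]
      refine Finset.sum_congr rfl (fun i _ => Finset.sum_congr rfl (fun j _ => ?_))
      ring
    rw [h3]
    exact h1
  intro a b hab
  by_contra hne
  have hfd : ∀ x, DifferentiableAt ℝ (fderiv ℝ K) x := fun x =>
    (hK.fderiv_right (m := 1) (by norm_num)).differentiable (by norm_num) x
  set v := b - a with hv
  have hv0 : v ≠ 0 := sub_ne_zero.mpr (Ne.symm hne)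
  have hline : ∀ s : ℝ, HasDerivAt (fun s : ℝ => a + s • v) v s := by
    intro s
    simpa using ((hasDerivAt_id s).smul_const v).const_add a
  have hder : ∀ s : ℝ, HasDerivAt (fun s : ℝ => fderiv ℝ K (a + s • v) v)
      (fderiv ℝ (fderiv ℝ K) (a + s • v) v v) s := by
    intro s
    have h1 := ((hfd (a + s • v)).hasFDerivAt).comp_hasDerivAt s (hline s)
    exact (ContinuousLinearMap.apply ℝ ℝ v).hasFDerivAt.comp_hasDerivAt s h1
  have hmono : StrictMono (fun s : ℝ => fderiv ℝ K (a + s • v) v) := by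
    refine strictMono_of_deriv_pos (fun s => ?_)
    rw [(hder s).deriv]
    exact hquad _ _ hv0
  have h01 := hmono (zero_lt_one)
  have hfe : fderiv ℝ K a = fderiv ℝ K b := by
    unfold gradient at hab
    exact (InnerProductSpace.toDual ℝ _).symm.injective hab
  simp only [zero_smul, add_zero, one_smul, hv, add_sub_cancel, hfe, lt_irrefl] at h01

lemma gp_gradient_ineq {E : Type*} [NormedAddCommGroup E] [InnerProductSpace ℝ E] [CompleteSpace E]
    (K : E → ℝ) (hc : ConvexOn ℝ Set.univ K) (g x : E) (hg : HasGradientAt K g x) (y : E) :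
    K x + ⟪g, y - x⟫ ≤ K y := by
  have hline : HasDerivAt (fun s : ℝ => x + s • (y - x)) (y - x) 0 := by
    simpa using ((hasDerivAt_id (0 : ℝ)).smul_const (y - x)).const_add x
  have hg' : HasFDerivAt K (InnerProductSpace.toDual ℝ E g) (x + (0 : ℝ) • (y - x)) := by
    simpa using hg.hasFDerivAt
  have hd := hg'.comp_hasDerivAt (0 : ℝ) hline
  have hcv : ConvexOn ℝ Set.univ (K ∘ fun s : ℝ => x + s • (y - x)) := by
    have h1 := hc.comp_affineMap (AffineMap.lineMap x y : ℝ →ᵃ[ℝ] E)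
    have h2 : (K ∘ (AffineMap.lineMap x y : ℝ →ᵃ[ℝ] E)) = (K ∘ fun s : ℝ => x + s • (y - x)) := by
      funext s
      simp [AffineMap.lineMap_apply, add_comm]
    rw [h2] at h1
    simpa using h1
  have h3 := hcv.le_slope_of_hasDerivAt (Set.mem_univ 0) (Set.mem_univ 1) zero_lt_one hd
  simp [slope_def_field] at h3
  linarith

lemma gp_coercive {E : Type*} [NormedAddCommGroup E] [ProperSpace E]
    (H : ℝ → E → ℝ) (hHc : Continuous (Function.uncurry H)) (T : ℝ) (hT : 0 < T)
    (hper : ∀ x t, H (t + T) x = H t x)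
    (hgrowth : ∃ nf : ℝ → ℝ, Tendsto (fun s => nf s / s) atTop atTop ∧
      ∀ (t : ℝ) (x : E), nf ‖x‖ ≤ H t x) (κ : ℝ) :
    ∃ C : ℝ, ∀ t x, κ * ‖x‖ - C ≤ H t x := by
  obtain ⟨nf, hnf, hH⟩ := hgrowth
  obtain ⟨S, hS⟩ := eventually_atTop.mp (hnf.eventually_ge_atTop κ)
  obtain ⟨M, hM0, hM⟩ := gp_bdd H hHc T hT hper (max S 1)
  refine ⟨|κ| * max S 1 + M, fun t x => ?_⟩
  have hm1 : (1 : ℝ) ≤ max S 1 := le_max_right _ _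
  have hp : 0 ≤ |κ| * max S 1 := by positivity
  rcases le_total ‖x‖ (max S 1) with hx | hx
  · have h1 := hM t x hx
    rw [Real.norm_eq_abs, abs_le] at h1
    have h2 : κ * ‖x‖ ≤ |κ| * max S 1 :=
      (mul_le_mul_of_nonneg_right (le_abs_self κ) (norm_nonneg x)).trans
        (mul_le_mul_of_nonneg_left hx (abs_nonneg κ))
    linarith [h1.1]
  · have h1 := hS ‖x‖ ((le_max_left _ _).trans hx)
    have hx0 : 0 < ‖x‖ := by linarith
    rw [le_div_iff₀ hx0] at h1
    linarith [hH t x]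

/-- (Ghoussoub–Preiss) If `H(t,x)` is `C²`, convex in `x`, `T`-periodic in `t`,
`(0, ε)`-subquadratic at infinity for every `ε > 0` uniformly in `t`, with everywhere positive
definite Hessian `H''_{xx}(t,x)`, then there is a sequence `x_k` of `C¹` `kT`-periodic
solutions of `ẋ = J ∇ₓH(t,x)` such that for every `k` there is `p₀` with
`p ≥ p₀ → x_{pk} ≠ x_k`. -/
theorem ghoussoub_preiss_subharmonics
    (n : ℕ) (hn : 1 ≤ n) (T : ℝ) (hT : 0 < T)
    (H : ℝ → EuclideanSpace ℝ (Fin (2*n)) → ℝ)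
    (hH2 : ContDiff ℝ 2 (Function.uncurry H))
    (hconv : ∀ t : ℝ, ConvexOn ℝ Set.univ (H t))
    (hper : ∀ (x : EuclideanSpace ℝ (Fin (2*n))) (t : ℝ), H (t + T) x = H t x)
    (hgrowth : ∃ nf : ℝ → ℝ, Tendsto (fun s => nf s / s) atTop atTop ∧
      ∀ (t : ℝ) (x : EuclideanSpace ℝ (Fin (2*n))), nf ‖x‖ ≤ H t x)
    (hupper : ∀ ε : ℝ, 0 < ε → ∃ c : ℝ,
      ∀ (t : ℝ) (x : EuclideanSpace ℝ (Fin (2*n))), H t x ≤ ε/2 * ‖x‖^2 + c)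
    (hposdef : ∀ (t : ℝ) (x : EuclideanSpace ℝ (Fin (2*n))),
      (hessianMatrix (H t) x).PosDef) :
    ∃ x : ℕ → ℝ → EuclideanSpace ℝ (Fin (2*n)),
      (∀ k : ℕ, 1 ≤ k →
        ContDiff ℝ 1 (x k) ∧
        (∀ t, x k (t + k * T) = x k t) ∧
        (∀ t, deriv (x k) t =
          (symplecticJ n).mulVec
            (gradient (F := EuclideanSpace ℝ (Fin (2*n))) (H t) (x k t)))) ∧
      ∀ k : ℕ, 1 ≤ k → ∃ p₀ : ℕ, ∀ p : ℕ, p₀ ≤ p → x (p * k) ≠ x k := by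
  let J : (EuclideanSpace ℝ (Fin (2 * n))) →L[ℝ] (EuclideanSpace ℝ (Fin (2 * n))) := Matrix.toEuclideanCLM (𝕜 := ℝ) (symplecticJ n)
  have hJapp : ∀ v : (EuclideanSpace ℝ (Fin (2 * n))), (J v).ofLp = (symplecticJ n).mulVec v.ofLp := fun v => rfl
  have hJ : ∀ v : (EuclideanSpace ℝ (Fin (2 * n))), J (J v) = -v := by
    intro v
    have h1 : J (J v) = (J * J) v := rfl
    have h2 : J * J = -1 := by
      simp only [J]
      rw [← map_mul, gp_symplectic_sq, map_neg, map_one]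
    rw [h1, h2]
    simp
  have hJs : ∀ v w : (EuclideanSpace ℝ (Fin (2 * n))), ⟪J v, w⟫ = -⟪v, J w⟫ := by
    intro v w
    have h1 : ContinuousLinearMap.adjoint J = -J := by
      have h2 : star J = -J := by
        simp only [J]
        rw [← map_star, ← map_neg]
        congr 1
        rw [← gp_symplectic_transpose]
        rfl
      exact h2
    rw [← ContinuousLinearMap.adjoint_inner_right, h1]
    simp
  let G : ℝ → (EuclideanSpace ℝ (Fin (2 * n))) → (EuclideanSpace ℝ (Fin (2 * n))) := fun t x => gradient (H t) x
  have hHc : Continuous (Function.uncurry H) := hH2.continuous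
  have hHt : ∀ t, ContDiff ℝ 2 (H t) := fun t =>
    hH2.comp (contDiff_const.prodMk contDiff_id : ContDiff ℝ 2 (fun x : (EuclideanSpace ℝ (Fin (2 * n))) => (t, x)))
  have hgrad : ∀ t x, HasGradientAt (H t) (G t x) x := fun t x =>
    ((hHt t).differentiable (by norm_num) x).hasGradientAt
  have hGc : Continuous (Function.uncurry G) := by
    have h1 : ∀ p : ℝ × (EuclideanSpace ℝ (Fin (2 * n))), Function.uncurry G p = (InnerProductSpace.toDual ℝ (EuclideanSpace ℝ (Fin (2 * n)))).symm
        ((fderiv ℝ (Function.uncurry H) p).comp (ContinuousLinearMap.inr ℝ ℝ (EuclideanSpace ℝ (Fin (2 * n))))) := by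
      rintro ⟨t, x⟩
      have h2 : HasFDerivAt (Function.uncurry H) (fderiv ℝ (Function.uncurry H) (t, x)) (t, x) :=
        (hH2.differentiable (by norm_num) (t, x)).hasFDerivAt
      have h3 : HasFDerivAt (H t) ((fderiv ℝ (Function.uncurry H) (t, x)).comp
          (ContinuousLinearMap.inr ℝ ℝ (EuclideanSpace ℝ (Fin (2 * n))))) x :=
        h2.comp x (hasFDerivAt_prodMk_right t x)
      show (InnerProductSpace.toDual ℝ (EuclideanSpace ℝ (Fin (2 * n)))).symm (fderiv ℝ (H t) x) = _
      rw [h3.fderiv]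
    have h4 : Continuous (fderiv ℝ (Function.uncurry H)) := hH2.continuous_fderiv (by norm_num)
    rw [show Function.uncurry G = _ from funext h1]
    exact (InnerProductSpace.toDual ℝ (EuclideanSpace ℝ (Fin (2 * n)))).symm.continuous.comp (h4.clm_comp continuous_const)
  have hineq : ∀ t x y, H t x + ⟪G t x, y - x⟫ ≤ H t y := fun t x y =>
    gp_gradient_ineq (H t) (hconv t) (G t x) x (hgrad t x) y
  have hinj : ∀ t, Function.Injective (G t) := fun t => gp_injective (H t) (hHt t) (hposdef t)
  have hcoer := gp_coercive H hHc T hT hper hgrowth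
  obtain ⟨C, hC⟩ := hcoer 1
  simp only [one_mul] at hC
  have hξ : ‖(EuclideanSpace.single (⟨0, by omega⟩ : Fin (2 * n)) (1 : ℝ) : (EuclideanSpace ℝ (Fin (2 * n))))‖ = 1 := by simp
  have hperk : ∀ (k : ℕ) (x : (EuclideanSpace ℝ (Fin (2 * n)))) (t : ℝ), H (t + k * T) x = H t x := fun k x t =>
    (Function.Periodic.nat_mul (f := fun t => H t x) (fun t => hper x t) k) t
  have hGperk : ∀ (k : ℕ) (x : (EuclideanSpace ℝ (Fin (2 * n)))) (t : ℝ), G (t + k * T) x = G t x := by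
    intro k x t
    have : H (t + k * T) = H t := funext fun x => hperk k x t
    simp only [G, this]
  have hex : ∀ k : ℕ, ∃ (x : ℝ → (EuclideanSpace ℝ (Fin (2 * n)))) (a : ℝ → ℝ), 1 ≤ k →
      ((∀ t, HasDerivAt x (J (G t (x t))) t) ∧
      (∀ t, x (t + k * T) = x t) ∧
      (∀ t, HasDerivAt a (1 / 2 * ⟪G t (x t), x t⟫ - H t (x t)) t) ∧
      a 0 = 0 ∧ a (k * T) ≤ C * (k * T) - (k * T) ^ 2 / (2 * π ^ 2)) := by
    intro k
    by_cases hk : 1 ≤ k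
    · have hk0 : (0 : ℝ) < k := by exact_mod_cast hk
      have hτ : 0 < k * T := by positivity
      obtain ⟨c, hc⟩ := hupper (1 / (2 * (k * T))) (by positivity)
      obtain ⟨x, a, h⟩ := gp_periodic J hJ hJs (k * T) hτ H G hHc hGc (hperk k) (hGperk k) hgrad
        hineq hinj hcoer c C (fun t x => by
          refine (hc t x).trans (le_of_eq ?_)
          congr 2
          field_simp
          norm_num) hC _ hξ
      exact ⟨x, a, fun _ => h⟩
    · exact ⟨0, 0, fun h => absurd h hk⟩
  choose x a hxa using hex
  have hxc : ∀ k, 1 ≤ k → Continuous (x k) := fun k hk =>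
    continuous_iff_continuousAt.mpr fun t => ((hxa k hk).1 t).continuousAt
  refine ⟨x, ?_, ?_⟩
  · intro k hk
    obtain ⟨h1, h2, -⟩ := hxa k hk
    have hder : deriv (x k) = fun t => J (G t (x k t)) := funext fun t => (h1 t).deriv
    refine ⟨?_, h2, ?_⟩
    · rw [contDiff_one_iff_deriv]
      refine ⟨fun t => (h1 t).differentiableAt, ?_⟩
      rw [hder]
      exact J.continuous.comp (hGc.comp (continuous_id.prodMk (hxc k hk)))
    · intro t
      rw [hder, hJapp]
  · intro k hk
    obtain ⟨h1, h2, h3, h4, h5⟩ := hxa k hk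
    have hk0 : (0 : ℝ) < k := by exact_mod_cast hk
    set τ : ℝ := k * T with hτdef
    have hτ : 0 < τ := by positivity
    have hπ := Real.pi_pos
    let g : ℝ → ℝ := fun t => 1 / 2 * ⟪G t (x k t), x k t⟫ - H t (x k t)
    have hgc : Continuous g := by
      have e1 : Continuous (fun t => G t (x k t)) :=
        hGc.comp (continuous_id.prodMk (hxc k hk))
      have e2 : Continuous (fun t => H t (x k t)) :=
        hHc.comp (continuous_id.prodMk (hxc k hk))
      exact (continuous_const.mul (e1.inner (hxc k hk))).sub e2
    have hgper : Function.Periodic g τ := by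
      intro t
      have e1 := h2 t
      have e2 := hGperk k (x k t) t
      have e3 := hperk k (x k t) t
      rw [← hτdef] at e2 e3
      simp only [g, e1, e2, e3]
    obtain ⟨p₀, hp₀⟩ := exists_nat_gt ((C * τ - a k τ) * (2 * π ^ 2) / τ ^ 2)
    refine ⟨p₀ + 1, fun p hp heq => ?_⟩
    have hpp : (p₀ : ℝ) ≤ p := by exact_mod_cast (by omega : p₀ ≤ p)
    have hp1 : 1 ≤ p := by omega
    have hp0 : (0 : ℝ) < p := by exact_mod_cast hp1
    obtain ⟨-, -, q3, q4, q5⟩ := hxa (p * k) (Nat.mul_pos hp1 hk)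
    rw [heq] at q3
    have i1 : ∫ t in (0 : ℝ)..τ, g t = a k τ := by
      rw [intervalIntegral.integral_eq_sub_of_hasDerivAt (fun t _ => h3 t)
        (hgc.intervalIntegrable _ _), h4, sub_zero]
    have i2 : ∫ t in (0 : ℝ)..(p * τ), g t = a (p * k) (p * τ) := by
      rw [intervalIntegral.integral_eq_sub_of_hasDerivAt (fun t _ => q3 t)
        (hgc.intervalIntegrable _ _), q4, sub_zero]
    have i3 := hgper.intervalIntegral_add_zsmul_eq (p : ℤ) 0
      (fun _ _ => hgc.intervalIntegrable _ _)
    simp only [zero_add, zsmul_eq_mul, Int.cast_natCast] at i3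
    rw [i1, i2] at i3
    have e3 : (((p * k : ℕ) : ℝ)) * T = p * τ := by push_cast; rw [hτdef]; ring
    rw [e3, i3] at q5
    have q6 : p * a k τ ≤ p * (C * τ - p * τ ^ 2 / (2 * π ^ 2)) := by
      refine q5.trans (le_of_eq ?_)
      ring
    have q7 := le_of_mul_le_mul_left q6 hp0
    have q8 : (C * τ - a k τ) * (2 * π ^ 2) / τ ^ 2 < p := lt_of_lt_of_le hp₀ hpp
    rw [div_lt_iff₀ (by positivity)] at q8
    have q9 : p * τ ^ 2 / (2 * π ^ 2) ≤ C * τ - a k τ := by linarith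
    rw [div_le_iff₀ (by positivity)] at q9
    linarith
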